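/- Let (R, 𝔪) be a Noetherian local ring with dim R > 0 and R/𝔪 infinite, let I be a proper ideal, let M be a finitely generated R-module, and let d be a positive integer with dim_R M ≤ d. Set M̄ = M/(0 :_M I^∞). Then j_d(I, M) = j_d(I, M̄); moreover, if M̄ ≠ 0 then dim_R(M̄/IM̄) < dim_R(M̄). -/

import Mathlib

open Filter

noncomputable section

/-- The length of a module, as the height of `⊤` in the submodule lattice. -/
def mLength (R M : Type*) [CommRing R] [AddCommGroup M] [Module R M] : ℕ∞ :=
  Order.height (⊤ : Submodule R M)

/-- The Krull dimension of a module, via the annihilator. -/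
def mDim (R M : Type*) [CommRing R] [AddCommGroup M] [Module R M] : WithBot ℕ∞ :=
  ringKrullDim (R ⧸ Module.annihilator R M)

/-- `H⁰_I(N)`: elements killed by a power of `I` (0-th local cohomology). -/
def H0 {R : Type*} [CommRing R] (I : Ideal R) (N : Type*) [AddCommGroup N] [Module R N] :
    Submodule R N :=
  ⨆ n : ℕ, Submodule.torsionBySet R N ((I ^ n : Ideal R) : Set R)

/-- `IⁿM/I^{n+1}M`, as a submodule of `M/I^{n+1}M`. -/
def gradedPiece {R : Type*} [CommRing R] (I : Ideal R) {M : Type*} [AddCommGroup M]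
    [Module R M] (n : ℕ) : Submodule R (M ⧸ (I ^ (n + 1) • ⊤ : Submodule R M)) :=
  Submodule.map (I ^ (n + 1) • ⊤ : Submodule R M).mkQ (I ^ n • ⊤ : Submodule R M)

/-- The `j`-multiplicity `j_d(I, M)`, defined as
`lim_n (d−1)!/n^(d−1) · length_R (H⁰_𝔪(IⁿM/I^{n+1}M))`. -/
def jMult {R : Type*} [CommRing R] (𝔪 I : Ideal R) (M : Type*) [AddCommGroup M]
    [Module R M] (d : ℕ) : ℝ :=
  limUnder atTop fun n : ℕ =>
    ((d - 1).factorial : ℝ) / (n : ℝ) ^ (d - 1) *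
      ((mLength R (H0 𝔪 (gradedPiece I (M := M) n))).toNat : ℝ)

/-- The Hilbert–Samuel multiplicity `e(I; N)` of a `d`-dimensional module `N`
(equal to `0` if `N = 0`), defined as `lim_n d!/n^d · length_R (N/IⁿN)`. -/
def hsMult {R : Type*} [CommRing R] (I : Ideal R) (N : Type*) [AddCommGroup N]
    [Module R N] (d : ℕ) : ℝ :=
  limUnder atTop fun n : ℕ =>
    (d.factorial : ℝ) / (n : ℝ) ^ d *
      ((mLength R (N ⧸ (I ^ n • ⊤ : Submodule R N))).toNat : ℝ)

/-- `K :_M I^∞ = ⋃ₙ (K :_M Iⁿ)`. -/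
def satur {R : Type*} [CommRing R] (I : Ideal R) {M : Type*} [AddCommGroup M] [Module R M]
    (K : Submodule R M) : Submodule R M :=
  Submodule.comap K.mkQ (H0 I (M ⧸ K))

/-- "For general elements `a₁, …, aᵢ` of `I`", i.e. for all `i`-tuples of elements of `I`
whose coefficient vectors with respect to any finite generating set of `I` avoid the zero
locus of some nonzero polynomial over the residue field `R/𝔪` (equivalently, whose images
lie in a suitable nonempty Zariski-open set of choices modulo `𝔪I`), property `P` holds. -/
def GeneralElts {R : Type*} [CommRing R] (𝔪 I : Ideal R) (i : ℕ)
    (P : (Fin i → R) → Prop) : Prop :=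
  ∀ (m : ℕ) (x : Fin m → R), Ideal.span (Set.range x) = I →
    ∃ F : MvPolynomial (Fin i × Fin m) R,
      MvPolynomial.map (Ideal.Quotient.mk 𝔪) F ≠ 0 ∧
      ∀ c : Fin i × Fin m → R,
        MvPolynomial.eval (fun p => Ideal.Quotient.mk 𝔪 (c p))
          (MvPolynomial.map (Ideal.Quotient.mk 𝔪) F) ≠ 0 →
        P fun j => ∑ l, c (j, l) * x l

section

variable {R : Type*} [CommRing R]

lemma mem_H0_iff {I : Ideal R} {N : Type*} [AddCommGroup N] [Module R N] {x : N} :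
    x ∈ H0 I N ↔ ∃ n : ℕ, ∀ a ∈ I ^ n, a • x = 0 := by
  have hmono : Monotone fun n : ℕ => Submodule.torsionBySet R N ((I ^ n : Ideal R) : Set R) :=
    fun m n h => Submodule.torsionBySet_le_torsionBySet_of_subset (Ideal.pow_le_pow_right h)
  rw [H0, Submodule.mem_iSup_of_directed _ hmono.directed_le]
  simp [Submodule.mem_torsionBySet_iff]

lemma mem_satur_bot_iff {I : Ideal R} {M : Type*} [AddCommGroup M] [Module R M] {x : M} :
    x ∈ satur I (⊥ : Submodule R M) ↔ ∃ n : ℕ, ∀ a ∈ I ^ n, a • x = 0 := by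
  rw [satur, Submodule.mem_comap, mem_H0_iff]
  simp [← Submodule.Quotient.mk_smul]

/-- Over a Noetherian ring a single power of `I` kills `0 :_M I^∞`. -/
lemma exists_pow_smul_satur_bot_eq_bot (I : Ideal R) (M : Type*) [AddCommGroup M] [Module R M]
    [IsNoetherian R M] : ∃ n : ℕ, I ^ n • satur I (⊥ : Submodule R M) = ⊥ := by
  let f : ℕ →o Submodule R M :=
    ⟨fun n => Submodule.torsionBySet R M ((I ^ n : Ideal R) : Set R), fun m n h =>
      Submodule.torsionBySet_le_torsionBySet_of_subset (Ideal.pow_le_pow_right h)⟩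
  obtain ⟨n, hn⟩ := monotone_stabilizes_iff_noetherian.mpr ‹IsNoetherian R M› f
  refine ⟨n, eq_bot_iff.mpr (Submodule.smul_le.mpr fun a ha x hx => ?_)⟩
  obtain ⟨m, hm⟩ := mem_satur_bot_iff.mp hx
  have hx' : x ∈ f (max n m) := f.monotone (le_max_right n m) <|
    (Submodule.mem_torsionBySet_iff _ _).mpr fun a => hm a a.2
  rw [← hn _ (le_max_left n m)] at hx'
  exact (Submodule.mem_torsionBySet_iff _ _).mp hx' ⟨a, ha⟩

lemma eq_zero_of_forall_smul_eq_zero (I : Ideal R) (M : Type*) [AddCommGroup M] [Module R M]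
    [IsNoetherian R M] (x : M ⧸ satur I (⊥ : Submodule R M)) (hx : ∀ a ∈ I, a • x = 0) :
    x = 0 := by
  obtain ⟨x, rfl⟩ := Submodule.Quotient.mk_surjective _ x
  obtain ⟨n, hn⟩ := exists_pow_smul_satur_bot_eq_bot I M
  rw [Submodule.Quotient.mk_eq_zero, mem_satur_bot_iff]
  refine ⟨n + 1, fun a ha => ?_⟩
  rw [pow_succ] at ha
  refine Submodule.mul_induction_on ha (fun b hb c hc => ?_) fun b c hb hc => ?_
  · have h : c • x ∈ satur I (⊥ : Submodule R M) := by
      simpa [← Submodule.Quotient.mk_smul, Submodule.Quotient.mk_eq_zero] using hx c hc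
    rw [mul_smul, ← Submodule.mem_bot R, ← hn]
    exact Submodule.smul_mem_smul hb h
  · rw [add_smul, hb, hc, add_zero]

/-- By Artin–Rees, `IⁿM` eventually meets `0 :_M I^∞` trivially. -/
lemma exists_forall_pow_smul_top_inf_satur_bot [IsNoetherianRing R] (I : Ideal R) (M : Type*)
    [AddCommGroup M] [Module R M] [Module.Finite R M] :
    ∃ n₀ : ℕ, ∀ n ≥ n₀, (I ^ n • ⊤ : Submodule R M) ⊓ satur I (⊥ : Submodule R M) = ⊥ := by
  obtain ⟨k, hk⟩ := I.exists_pow_inf_eq_pow_smul (satur I (⊥ : Submodule R M))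
  obtain ⟨m, hm⟩ := exists_pow_smul_satur_bot_eq_bot I M
  refine ⟨k + m, fun n hn => ?_⟩
  rw [hk n (by omega), eq_bot_iff]
  refine le_trans ?_ hm.le
  exact Submodule.smul_mono (Ideal.pow_le_pow_right (by omega)) inf_le_right

lemma mLength_congr {N N' : Type*} [AddCommGroup N] [Module R N] [AddCommGroup N'] [Module R N']
    (e : N ≃ₗ[R] N') : mLength R N = mLength R N' := by
  rw [mLength, mLength, ← Order.height_orderIso (Submodule.orderIsoMapComap e)]
  simp

/-- The restriction of a linear equivalence to `H⁰_I`. -/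
def H0Congr (I : Ideal R) {N N' : Type*} [AddCommGroup N] [Module R N] [AddCommGroup N']
    [Module R N'] (e : N ≃ₗ[R] N') : H0 I N ≃ₗ[R] H0 I N' :=
  e.ofSubmodules _ _ <| by
    ext x
    simp only [Submodule.mem_map_equiv, mem_H0_iff, ← map_smul, map_eq_zero_iff _ e.symm.injective]

/-- If `IⁿM` meets `K` trivially, then `IⁿM/I^{n+1}M` does not change on passing to `M/K`. -/
lemma nonempty_gradedPiece_equiv_quotient (I : Ideal R) {M : Type*} [AddCommGroup M] [Module R M]
    (K : Submodule R M) (n : ℕ) (h : (I ^ n • ⊤ : Submodule R M) ⊓ K = ⊥) :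
    Nonempty (gradedPiece I (M := M) n ≃ₗ[R] gradedPiece I (M := M ⧸ K) n) := by
  have hmap (k : ℕ) :
      (I ^ k • ⊤ : Submodule R M).map K.mkQ = (I ^ k • ⊤ : Submodule R (M ⧸ K)) := by
    rw [Submodule.map_smul'', Submodule.map_top, Submodule.range_mkQ]
  let f : (M ⧸ (I ^ (n + 1) • ⊤ : Submodule R M)) →ₗ[R]
      (M ⧸ K) ⧸ (I ^ (n + 1) • ⊤ : Submodule R (M ⧸ K)) :=
    Submodule.mapQ _ _ K.mkQ (Submodule.map_le_iff_le_comap.mp (hmap (n + 1)).le)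
  have hf : (gradedPiece I (M := M) n).map f = gradedPiece I (M := M ⧸ K) n := by
    rw [gradedPiece, gradedPiece, ← hmap n, ← Submodule.map_comp, ← Submodule.map_comp]
    rfl
  have hinj : Set.InjOn f (gradedPiece I (M := M) n) := by
    refine LinearMap.injOn_of_disjoint_ker subset_rfl (Submodule.disjoint_def.mpr ?_)
    rintro _ ⟨x, hx, rfl⟩ hx'
    have hx' : K.mkQ x ∈ (I ^ (n + 1) • ⊤ : Submodule R (M ⧸ K)) := by
      rw [LinearMap.mem_ker] at hx'
      exact (Submodule.Quotient.mk_eq_zero _).mp hx'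
    rw [← hmap] at hx'
    obtain ⟨y, hy, hyx⟩ := hx'
    have hsub : y - x ∈ (I ^ n • ⊤ : Submodule R M) ⊓ K :=
      ⟨sub_mem (Submodule.smul_mono_left (Ideal.pow_le_pow_right n.le_succ) hy) hx,
        (Submodule.Quotient.eq K).mp hyx⟩
    rw [h, Submodule.mem_bot, sub_eq_zero] at hsub
    exact (Submodule.Quotient.mk_eq_zero _).mpr (hsub ▸ hy)
  refine ⟨LinearEquiv.ofBijective (f.restrict (p := gradedPiece I n) (q := gradedPiece I n)
    fun x hx => hf ▸ Submodule.mem_map_of_mem hx) ⟨fun x y hxy => ?_, fun y => ?_⟩⟩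
  · exact Subtype.ext (hinj x.2 y.2 (congrArg Subtype.val hxy))
  · obtain ⟨x, hx, hxy⟩ := hf.ge y.2
    exact ⟨⟨x, hx⟩, Subtype.ext hxy⟩

/-- If every prime over `B` strictly contains a prime over `A`, then `dim R/B + 1 ≤ dim R/A`. -/
lemma ringKrullDim_quotient_add_one_le {A B : Ideal R} (hA : A ≠ ⊤)
    (h : ∀ p : PrimeSpectrum R, B ≤ p.asIdeal → ∃ q : PrimeSpectrum R, A ≤ q.asIdeal ∧ q < p)
    (hAB : A ≤ B) : ringKrullDim (R ⧸ B) + 1 ≤ ringKrullDim (R ⧸ A) := by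
  by_cases hB : B = ⊤
  · rw [hB, ringKrullDim_eq_bot_of_subsingleton]
    simp
  have hne (C : Ideal R) (hC : C ≠ ⊤) : Nonempty (PrimeSpectrum.zeroLocus (R := R) C) := by
    rwa [Set.nonempty_coe_sort, Set.nonempty_iff_ne_empty, ne_eq,
      PrimeSpectrum.zeroLocus_empty_iff_eq_top]
  have := hne A hA
  have := hne B hB
  rw [ringKrullDim_quotient, Order.krullDim_eq_iSup_length, ringKrullDim_quotient,
    Order.krullDim_eq_iSup_length, ← WithBot.coe_one, ← WithBot.coe_add,
    ENat.iSup_add, WithBot.coe_le_coe, iSup_le_iff]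
  intro l
  obtain ⟨q, hq, hlt⟩ := h l.head.1 l.head.2
  let g : PrimeSpectrum.zeroLocus (R := R) B → PrimeSpectrum.zeroLocus (R := R) A :=
    fun p => ⟨p.1, hAB.trans p.2⟩
  have hg : StrictMono g := fun _ _ => id
  let q' : PrimeSpectrum.zeroLocus (R := R) A := ⟨q, hq⟩
  have hlt' : q' < (l.map g hg).head := hlt
  refine le_trans ?_ (le_iSup _ ((l.map g hg).cons q' hlt'))
  simp

lemma mDim_quotient_smul_top_lt [IsNoetherianRing R] [IsLocalRing R] (I : Ideal R) (N : Type*)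
    [AddCommGroup N] [Module R N] [Module.Finite R N] [Nontrivial N]
    (h : ∀ x : N, (∀ a ∈ I, a • x = 0) → x = 0) :
    mDim R (N ⧸ (I • ⊤ : Submodule R N)) < mDim R N := by
  have hA : Module.annihilator R N ≠ ⊤ := by
    rw [Ne, Module.annihilator_eq_top_iff]
    exact not_subsingleton N
  have : Nontrivial (R ⧸ Module.annihilator R N) := Ideal.Quotient.nontrivial_iff.mpr hA
  have : IsLocalRing (R ⧸ Module.annihilator R N) :=
    .of_surjective' (Ideal.Quotient.mk _) Ideal.Quotient.mk_surjective
  have hAB : Module.annihilator R N ≤ Module.annihilator R (N ⧸ (I • ⊤ : Submodule R N)) :=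
    (Submodule.mkQ _).annihilator_le_of_surjective (Submodule.mkQ_surjective _)
  have hIB : I ≤ Module.annihilator R (N ⧸ (I • ⊤ : Submodule R N)) := fun a ha => by
    rw [Module.mem_annihilator]
    rintro ⟨x⟩
    exact (Submodule.Quotient.mk_eq_zero _).mpr (Submodule.smul_mem_smul ha trivial)
  have hle := ringKrullDim_quotient_add_one_le hA (fun p hp => ?_) hAB
  · have htop := ringKrullDim_ne_top (R := R ⧸ Module.annihilator R N)
    have hbot := ringKrullDim_ne_bot (R := R ⧸ Module.annihilator R N)
    rw [mDim, mDim]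
    generalize ringKrullDim (R ⧸ Module.annihilator R N) = b at *
    generalize ringKrullDim (R ⧸ Module.annihilator R (N ⧸ (I • ⊤ : Submodule R N))) = a at *
    cases b with
    | bot => simp at hbot
    | coe b =>
    cases a with
    | bot => exact WithBot.bot_lt_coe b
    | coe a =>
      have hb : b ≠ ⊤ := fun hb => htop (hb ▸ rfl)
      have hab : a + 1 ≤ b := by exact_mod_cast hle
      have ha : a ≠ ⊤ := by
        rintro rfl
        exact hb (top_le_iff.mp (by simpa using hab))
      exact WithBot.coe_lt_coe.mpr ((ENat.add_one_le_iff ha).mp hab)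
  · obtain ⟨q, hq, hqp⟩ := Ideal.exists_minimalPrimes_le (hAB.trans hp)
    obtain ⟨hqprime, x, rfl⟩ := isAssociatedPrime_iff.mp <| AssociatedPrimes.mem_iff.mp <|
      Module.associatedPrimes.minimalPrimes_annihilator_subset_associatedPrimes R N hq
    refine ⟨⟨_, hq.1.1⟩, hq.1.2, lt_of_le_of_ne hqp fun heq => ?_⟩
    have hIq : I ≤ (⊥ : Submodule R N).colon {x} :=
      (hIB.trans hp).trans (congrArg PrimeSpectrum.asIdeal heq).ge
    have hx : x = 0 := h x fun a ha => by simpa [Submodule.mem_colon_singleton] using hIq ha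
    exact hqprime.ne_top (by simp [hx])

end

/-- Lemma 3.3: with `M̄ = M/(0 :_M I^∞)`, `j_d(I, M) = j_d(I, M̄)`; moreover if `M̄ ≠ 0`
then `dim (M̄/IM̄) < dim M̄`. -/
theorem stmt_7 {R : Type*} [CommRing R] [IsNoetherianRing R] [IsLocalRing R]
    (hdim : 0 < ringKrullDim R) (hres : Infinite (IsLocalRing.ResidueField R))
    (I : Ideal R) (hI : I ≠ ⊤)
    (M : Type*) [AddCommGroup M] [Module R M] [Module.Finite R M]
    (d : ℕ) (hd : 0 < d) (hMd : mDim R M ≤ (d : WithBot ℕ∞)) :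
    jMult (IsLocalRing.maximalIdeal R) I M d =
      jMult (IsLocalRing.maximalIdeal R) I (M ⧸ satur I (⊥ : Submodule R M)) d ∧
    (Nontrivial (M ⧸ satur I (⊥ : Submodule R M)) →
      mDim R ((M ⧸ satur I (⊥ : Submodule R M)) ⧸
          (I • ⊤ : Submodule R (M ⧸ satur I (⊥ : Submodule R M)))) <
        mDim R (M ⧸ satur I (⊥ : Submodule R M))) := by
  refine ⟨?_, fun _ => mDim_quotient_smul_top_lt I _ (eq_zero_of_forall_smul_eq_zero I M)⟩
  obtain ⟨n₀, hn₀⟩ := exists_forall_pow_smul_top_inf_satur_bot I M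
  rw [jMult, jMult, limUnder, limUnder]
  congr 1
  refine Filter.map_congr (eventually_atTop.mpr ⟨n₀, fun n hn => ?_⟩)
  obtain ⟨e⟩ := nonempty_gradedPiece_equiv_quotient I _ n (hn₀ n hn)
  simp only [mLength_congr (H0Congr (IsLocalRing.maximalIdeal R) e)]

end
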